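/- arXiv:2205.07581 — 3 statements merged into one kernel-verified Lean document; each statement's English description precedes it below -/
import Mathlib

section
/- Recurrence for colored Eulerian numbers with last-color 0: A^{(0)}(d+1, k+1, m) = ∑_{j=k}^{d−1} A^{(0)}(d, j+1, m) + ∑_{s=1}^{r−1} ∑_{j=0}^{d−1} A^{(s)}(d, j+1, m) + ∑_{j=0}^{k−1} A^{(0)}(d, j+1, m−1), for all 0 ≤ k ≤ d and 0 ≤ m ≤ d. -/
/-- Number of descents of an `r`-colored permutation of `[d]` (zero-based indexing),
with the conventions σ_{d+1} = d+1, ε_{d+1} = 0: position `i` (1-based `i+1`) is a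
descent iff ε_{i+1} > ε_{i+2}, or ε_{i+1} = ε_{i+2} and σ_{i+1} > σ_{i+2}; the last
position is a descent iff its color is nonzero. -/
noncomputable def colDes (d r : ℕ) (σ : Fin d → Fin d) (ε : Fin d → Fin r) : ℕ :=
  Nat.card {i : Fin d //
    if h : i.1 + 1 < d then
      ε ⟨i.1 + 1, h⟩ < ε i ∨ (ε i = ε ⟨i.1 + 1, h⟩ ∧ σ ⟨i.1 + 1, h⟩ < σ i)
    else 0 < (ε i : ℕ)}

/-- The bar involution on colors: 0 ↦ 0 and s ↦ r - s for s ≠ 0. -/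
def barColor {r : ℕ} (e : Fin r) : Fin r :=
  if h : (e : ℕ) = 0 then e else ⟨r - e.1, by have := e.isLt; omega⟩

/-- `countA r d j s m` is the number `A^{(s)}(d, j, m)` of `r`-colored permutations
(σ, ε) of `[d]` with ε_1 = 0, σ_d = d + 1 - j, ε_d = s and exactly `m` descents. -/
noncomputable def countA (r d j s m : ℕ) : ℕ :=
  Nat.card {p : (Fin d → Fin d) × (Fin d → Fin r) //
    Function.Bijective p.1 ∧
    (∀ i : Fin d, i.1 = 0 → (p.2 i : ℕ) = 0) ∧
    (∀ i : Fin d, i.1 = d - 1 → (p.1 i : ℕ) = d - j ∧ (p.2 i : ℕ) = s) ∧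
    colDes d r p.1 p.2 = m}

open Classical in
theorem colDes_succ (n r : ℕ) (σ : Fin (n + 1) → Fin (n + 1)) (ε : Fin (n + 1) → Fin r) :
    colDes (n + 1) r σ ε =
      (∑ i : Fin n, if ε i.succ < ε i.castSucc ∨
        (ε i.castSucc = ε i.succ ∧ σ i.succ < σ i.castSucc) then 1 else 0) +
      if 0 < (ε (Fin.last n) : ℕ) then 1 else 0 := by
  unfold colDes
  rw [Nat.card_eq_fintype_card, Fintype.card_subtype, Finset.card_filter,
    Fin.sum_univ_castSucc]
  congr 1
  · refine Finset.sum_congr rfl fun i _ => ?_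
    have h : (i.castSucc : Fin (n + 1)).1 + 1 < n + 1 := by simp
    simp only [dif_pos h]
    rfl
  · simp

/-- Append the value `v`, with color `0`, to a colored permutation, standardizing its entries. -/
def snocColored {d q : ℕ} (v : Fin (d + 1)) (p : (Fin d → Fin d) × (Fin d → Fin (q + 1))) :
    (Fin (d + 1) → Fin (d + 1)) × (Fin (d + 1) → Fin (q + 1)) :=
  (Fin.snoc (α := fun _ => Fin (d + 1)) (fun i => v.succAbove (p.1 i)) v,
    Fin.snoc (α := fun _ => Fin (q + 1)) p.2 0)

open Classical in
theorem colDes_snocColored {n q : ℕ} (v : Fin (n + 2))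
    (p : (Fin (n + 1) → Fin (n + 1)) × (Fin (n + 1) → Fin (q + 1))) :
    colDes (n + 2) (q + 1) (snocColored v p).1 (snocColored v p).2 =
      colDes (n + 1) (q + 1) p.1 p.2 +
        if (p.2 (Fin.last n) : ℕ) = 0 ∧ (v : ℕ) ≤ p.1 (Fin.last n) then 1 else 0 := by
  rw [colDes_succ, colDes_succ, Fin.sum_univ_castSucc]
  have h1 : ∀ i : Fin (n + 1), (snocColored v p).1 i.castSucc = v.succAbove (p.1 i) := fun i => by
    simp [snocColored]
  have h2 : ∀ i : Fin (n + 1), (snocColored v p).2 i.castSucc = p.2 i := fun i => by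
    simp [snocColored]
  have h3 : (snocColored v p).1 (Fin.last _) = v := by simp [snocColored]
  have h4 : (snocColored v p).2 (Fin.last _) = 0 := by simp [snocColored]
  simp only [Fin.succ_castSucc, Fin.succ_last, h1, h2, h3, h4, Fin.succAbove_lt_succAbove_iff,
    Fin.lt_succAbove_iff_le_castSucc]
  rcases Nat.eq_zero_or_pos (p.2 (Fin.last n) : ℕ) with h | h
  · have h' : p.2 (Fin.last n) = 0 := Fin.ext h
    simp [h', Fin.le_def]
  · have h' : 0 < p.2 (Fin.last n) := h
    simp [h', h'.ne']

theorem countA_succ_zero {n q k m : ℕ} (hk : k ≤ n + 1) (v : Fin (n + 2))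
    (hv : (v : ℕ) = n + 1 - k) :
    countA (q + 1) (n + 2) (k + 1) 0 m =
      Nat.card {p : (Fin (n + 1) → Fin (n + 1)) × (Fin (n + 1) → Fin (q + 1)) //
        Function.Bijective p.1 ∧ (p.2 0 : ℕ) = 0 ∧
        colDes (n + 2) (q + 1) (snocColored v p).1 (snocColored v p).2 = m} := by
  symm
  unfold countA
  have hlast : ∀ i : Fin (n + 2), i.1 = n + 2 - 1 → i = Fin.last _ := fun i hi => by
    ext; simpa using hi
  refine Nat.card_congr (Equiv.ofBijective (fun p => ⟨snocColored v p.1, ?_⟩) ⟨?_, ?_⟩)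
  · obtain ⟨p, hp, hp0, hpm⟩ := p
    refine ⟨?_, ?_, ?_, hpm⟩
    · rw [← Finite.injective_iff_bijective]
      simp only [snocColored, Fin.snoc_injective_iff]
      refine ⟨fun a b hab => hp.1 (Fin.succAbove_right_injective hab), ?_⟩
      rintro ⟨i, hi⟩
      exact Fin.succAbove_ne _ _ hi
    · intro i hi
      obtain rfl : i = Fin.castSucc 0 := Fin.ext hi
      simpa [snocColored, -Fin.castSucc_zero] using hp0
    · intro i hi
      rw [hlast i hi]
      simp [snocColored, hv]
  · rintro ⟨p, hp⟩ ⟨p', hp'⟩ h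
    have h1 := congrArg (fun x => x.1.1) h
    have h2 := congrArg (fun x => x.1.2) h
    simp only [snocColored] at h1 h2
    refine Subtype.ext (Prod.ext (funext fun i => ?_) (funext fun i => ?_))
    · simpa using congrFun h1 i.castSucc
    · simpa using congrFun h2 i.castSucc
  · rintro ⟨⟨σ, ε⟩, hσ, h0, hl, hm⟩
    obtain ⟨hl1, hl2⟩ := hl (Fin.last _) rfl
    have hlv : σ (Fin.last _) = v := Fin.ext (by simp only at hl1; omega)
    have hex : ∀ i : Fin (n + 1), ∃ j, v.succAbove j = σ i.castSucc := fun i =>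
      Fin.exists_succAbove_eq fun h => (Fin.castSucc_lt_last i).ne (hσ.1 (h.trans hlv.symm))
    choose τ hτ using hex
    have hp : snocColored v (τ, fun i => ε i.castSucc) = (σ, ε) := by
      refine Prod.ext (funext fun i => ?_) (funext fun i => ?_)
      · refine Fin.lastCases ?_ (fun i => ?_) i
        · simp [snocColored, hlv]
        · simp [snocColored, hτ]
      · refine Fin.lastCases ?_ (fun i => ?_) i
        · simpa [snocColored] using (Fin.ext hl2 : ε (Fin.last _) = 0).symm
        · simp [snocColored]
    refine ⟨⟨(τ, fun i => ε i.castSucc), ?_, ?_, ?_⟩, Subtype.ext hp⟩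
    · rw [← Finite.injective_iff_bijective]
      intro a b hab
      have := hσ.1 ((hτ a).symm.trans ((congrArg _ hab).trans (hτ b)))
      simpa using this
    · exact h0 _ rfl
    · rw [hp]; exact hm

open Classical in
theorem countA_eq_card_filter (r n j s m : ℕ) :
    countA r (n + 1) (j + 1) s m =
      (Finset.univ.filter fun p : (Fin (n + 1) → Fin (n + 1)) × (Fin (n + 1) → Fin r) =>
        (Function.Bijective p.1 ∧ (p.2 0 : ℕ) = 0) ∧ colDes (n + 1) r p.1 p.2 = m ∧
          (p.1 (Fin.last n) : ℕ) = n - j ∧ (p.2 (Fin.last n) : ℕ) = s).card := by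
  unfold countA
  rw [Nat.card_eq_fintype_card, Fintype.card_subtype]
  congr 1
  refine Finset.filter_congr fun p _ => ?_
  have e1 : (∀ i : Fin (n + 1), i.1 = 0 → (p.2 i : ℕ) = 0) ↔ (p.2 0 : ℕ) = 0 :=
    ⟨fun h => h 0 rfl, fun h i hi => by rwa [show i = 0 from Fin.ext hi]⟩
  have e2 : (∀ i : Fin (n + 1), i.1 = n + 1 - 1 →
      (p.1 i : ℕ) = n + 1 - (j + 1) ∧ (p.2 i : ℕ) = s) ↔
      (p.1 (Fin.last n) : ℕ) = n - j ∧ (p.2 (Fin.last n) : ℕ) = s :=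
    ⟨fun h => by simpa using h (Fin.last n) rfl,
      fun h i hi => by
        rw [show i = Fin.last n from Fin.ext (by simpa using hi)]
        simpa using h⟩
  rw [e1, e2]
  tauto

theorem countA_recurrence_zero (r d : ℕ) (hr : 1 ≤ r) (hd : 1 ≤ d)
    (k m : ℕ) (hk : k ≤ d) (hm : m ≤ d) :
    countA r (d + 1) (k + 1) 0 m =
      (∑ j ∈ Finset.Icc k (d - 1), countA r d (j + 1) 0 m) +
      (∑ s ∈ Finset.Icc 1 (r - 1), ∑ j ∈ Finset.range d, countA r d (j + 1) s m) +
      (∑ j ∈ Finset.range k, if 1 ≤ m then countA r d (j + 1) 0 (m - 1) else 0) := by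
  classical
  obtain ⟨q, rfl⟩ : ∃ q, r = q + 1 := ⟨r - 1, by omega⟩
  obtain ⟨n, rfl⟩ : ∃ n, d = n + 1 := ⟨d - 1, by omega⟩
  set v : Fin (n + 2) := ⟨n + 1 - k, by omega⟩ with hv
  rw [countA_succ_zero hk v rfl, Nat.card_eq_fintype_card, Fintype.card_subtype]
  simp only [colDes_snocColored]
  have hfib : ∀ s j : ℕ, j < n + 1 →
      (if s = 0 ∧ j < k then (if 1 ≤ m then countA (q + 1) (n + 1) (j + 1) 0 (m - 1) else 0)
        else countA (q + 1) (n + 1) (j + 1) s m) =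
      (Finset.univ.filter fun p : (Fin (n + 1) → Fin (n + 1)) × (Fin (n + 1) → Fin (q + 1)) =>
        (Function.Bijective p.1 ∧ (p.2 0 : ℕ) = 0 ∧
          (colDes (n + 1) (q + 1) p.1 p.2 +
            if (p.2 (Fin.last n) : ℕ) = 0 ∧ (v : ℕ) ≤ p.1 (Fin.last n) then 1 else 0) = m) ∧
          ((p.2 (Fin.last n) : ℕ), n - (p.1 (Fin.last n) : ℕ)) = (s, j)).card := by
    intro s j hj
    have hvj : ∀ p : (Fin (n + 1) → Fin (n + 1)) × (Fin (n + 1) → Fin (q + 1)),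
        n - (p.1 (Fin.last n) : ℕ) = j → ((v : ℕ) ≤ p.1 (Fin.last n) ↔ j < k) := fun p h => by
      have := (p.1 (Fin.last n)).isLt
      simp only [hv]
      omega
    have hu : ∀ p : (Fin (n + 1) → Fin (n + 1)) × (Fin (n + 1) → Fin (q + 1)),
        (p.1 (Fin.last n) : ℕ) = n - j ↔ n - (p.1 (Fin.last n) : ℕ) = j := fun p => by
      have := (p.1 (Fin.last n)).isLt
      omega
    simp only [countA_eq_card_filter, hu, Prod.mk.injEq]
    split_ifs with h h1
    · congr 1
      refine Finset.filter_congr fun p _ => ?_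
      have := hvj p
      grind
    · symm
      rw [Finset.card_eq_zero, Finset.filter_eq_empty_iff]
      intro p _
      have := hvj p
      grind
    · congr 1
      refine Finset.filter_congr fun p _ => ?_
      have := hvj p
      grind
  have hmaps : ∀ p ∈ Finset.univ.filter fun p :
      (Fin (n + 1) → Fin (n + 1)) × (Fin (n + 1) → Fin (q + 1)) =>
        Function.Bijective p.1 ∧ (p.2 0 : ℕ) = 0 ∧
          (colDes (n + 1) (q + 1) p.1 p.2 +
            if (p.2 (Fin.last n) : ℕ) = 0 ∧ (v : ℕ) ≤ p.1 (Fin.last n) then 1 else 0) = m,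
      ((p.2 (Fin.last n) : ℕ), n - (p.1 (Fin.last n) : ℕ)) ∈
        Finset.range (q + 1) ×ˢ Finset.range (n + 1) := fun p _ => by
    have := (p.2 (Fin.last n)).isLt
    simp only [Finset.mem_product, Finset.mem_range]
    omega
  rw [Finset.card_eq_sum_card_fiberwise hmaps, Finset.sum_product]
  simp only [Finset.filter_filter]
  rw [Finset.sum_congr rfl fun s _ => Finset.sum_congr rfl fun j hj =>
    (hfib s j (Finset.mem_range.1 hj)).symm]
  rw [Finset.sum_range_succ', add_comm]
  have hs : ∑ s ∈ Finset.Icc 1 (q + 1 - 1), ∑ j ∈ Finset.range (n + 1),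
      countA (q + 1) (n + 1) (j + 1) s m =
      ∑ s ∈ Finset.range q, ∑ j ∈ Finset.range (n + 1),
        countA (q + 1) (n + 1) (j + 1) (s + 1) m := by
    have hI : Finset.Icc 1 (q + 1 - 1) = Finset.Ico (0 + 1) (q + 1) := by ext; simp
    simpa only [hI, Finset.range_eq_Ico] using (Finset.sum_Ico_add' (fun s =>
      ∑ j ∈ Finset.range (n + 1), countA (q + 1) (n + 1) (j + 1) s m) 0 q 1).symm
  have hj : Finset.Icc k (n + 1 - 1) = Finset.Ico k (n + 1) := rfl
  rw [hs, hj, add_right_comm]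
  congr 1
  rw [← Finset.sum_range_add_sum_Ico _ hk, add_comm]
  congr 1
  · refine Finset.sum_congr rfl fun j hj => ?_
    rw [if_neg]
    have := Finset.mem_Ico.1 hj
    omega
  · refine Finset.sum_congr rfl fun j hj => ?_
    rw [if_pos ⟨rfl, Finset.mem_range.1 hj⟩]
end

section
/- Slide-descent identity: let a^{(0)}(d, k, s) denote the number of r-colored permutations σ of [d] with ε_1 = 0, ε_d = 0, exactly k descents, and exactly s+1 slides. Then a^{(0)}(d, k, s) = C(d−1−2s, k−s) · a^{(0)}(d, s, s) for all 0 ≤ s ≤ k. -/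
/-- Descents of the extended word ∞^{(0)} σ_1^{(ε_1)} ⋯ σ_d^{(ε_d)} (d+1)^{(0)},
at positions 0, 1, …, d, in the colored order (compare colors first, then values;
∞ is larger than every value). -/
def extDes (d r : ℕ) (σ : Fin d → Fin d) (ε : Fin d → Fin r) (i : ℕ) : Prop :=
  if i = 0 then ∀ t : Fin d, t.1 = 0 → (ε t : ℕ) = 0
  else if h : i < d then
    ε ⟨i, h⟩ < ε ⟨i - 1, by omega⟩ ∨
      (ε ⟨i - 1, by omega⟩ = ε ⟨i, h⟩ ∧ σ ⟨i, h⟩ < σ ⟨i - 1, by omega⟩)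
  else if i = d then ∀ t : Fin d, t.1 = d - 1 → 0 < (ε t : ℕ)
  else False

/-- The number of slides: maximal decreasing runs of length at least 2 of the extended
word, i.e. descent positions not immediately preceded by a descent position. -/
noncomputable def slideCount (d r : ℕ) (σ : Fin d → Fin d) (ε : Fin d → Fin r) : ℕ :=
  Nat.card {i : ℕ // i ≤ d ∧ extDes d r σ ε i ∧ (i = 0 ∨ ¬ extDes d r σ ε (i - 1))}

/-- `aColored0 r d k s` is the number of r-colored permutations of [d] with
ε_1 = 0, ε_d = 0, exactly k descents and exactly s + 1 slides. -/
noncomputable def aColored0 (r d k s : ℕ) : ℕ :=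
  Nat.card {p : (Fin d → Fin d) × (Fin d → Fin r) //
    Function.Bijective p.1 ∧
    (∀ i : Fin d, i.1 = 0 → (p.2 i : ℕ) = 0) ∧
    (∀ i : Fin d, i.1 = d - 1 → (p.2 i : ℕ) = 0) ∧
    colDes d r p.1 p.2 = k ∧ slideCount d r p.1 p.2 = s + 1}

section DescentPatterns

open Finset Classical

/-- Inserting a term `c` right after position `i` of a finite sum. -/
theorem sum_range_succ_of_insert (f g : ℕ → ℕ) (i c N : ℕ) (hi : i < N)
    (hle : ∀ j, j ≤ i → g j = f j) (hc : g (i + 1) = c) (hgt : ∀ j, i < j → g (j + 1) = f j) :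
    ∑ j ∈ range (N + 1), g j = ∑ j ∈ range N, f j + c := by
  induction N with
  | zero => omega
  | succ N ih =>
    rw [sum_range_succ]
    rcases Nat.lt_succ_iff_lt_or_eq.mp hi with h | rfl
    · rw [ih h, hgt N h, sum_range_succ]; omega
    · rw [hc, sum_congr rfl fun j hj => hle j (by simp at hj; omega)]

/-- The pattern obtained from `D` by repeating its entry at position `i`. -/
def duplicateAt (i : ℕ) (D : ℕ → Prop) (j : ℕ) : Prop :=
  if j ≤ i then D j else D (j - 1)

/-- A descent pattern on positions `0, …, N` starting with a descent, ending with an ascent,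
and having `k + 1` descents in `s + 1` maximal runs of descents. -/
def IsPattern (N k s : ℕ) (D : ℕ → Prop) : Prop :=
  D 0 ∧ ¬ D N ∧ ∑ j ∈ range (N + 1), (if D j then 1 else 0) = k + 1 ∧
    ∑ j ∈ range (N + 1), (if D j ∧ (j = 0 ∨ ¬ D (j - 1)) then 1 else 0) = s + 1

theorem sum_duplicateAt (D : ℕ → Prop) (i N : ℕ) (hi : i ≤ N) :
    ∑ j ∈ range (N + 1 + 1), (if duplicateAt i D j then 1 else 0) =
      ∑ j ∈ range (N + 1), (if D j then 1 else 0) + if D i then 1 else 0 := by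
  apply sum_range_succ_of_insert _ _ i _ _ (by omega)
  · intro j hj; simp [duplicateAt, hj]
  · simp [duplicateAt]
  · intro j hj; simp [duplicateAt, show ¬ j + 1 ≤ i by omega]

theorem sum_runStarts_duplicateAt (D : ℕ → Prop) (i N : ℕ) (hi : i ≤ N) :
    ∑ j ∈ range (N + 1 + 1),
        (if duplicateAt i D j ∧ (j = 0 ∨ ¬ duplicateAt i D (j - 1)) then 1 else 0) =
      ∑ j ∈ range (N + 1), (if D j ∧ (j = 0 ∨ ¬ D (j - 1)) then 1 else 0) := by
  rw [sum_range_succ_of_insert _ _ i 0 _ (by omega), add_zero]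
  · intro j hj; simp [duplicateAt, hj, show j - 1 ≤ i by omega]
  · simp [duplicateAt]
  · intro j hj
    simp [duplicateAt, show ¬ j + 1 ≤ i by omega, show ¬ j ≤ i by omega, show j ≠ 0 by omega]

theorem isPattern_duplicateAt_descent {D : ℕ → Prop} {i N : ℕ} (k s : ℕ) (hi : i ≤ N)
    (hD : D i) : IsPattern (N + 1) (k + 1) s (duplicateAt i D) ↔ IsPattern N k s D := by
  unfold IsPattern
  rw [sum_duplicateAt D i N hi, sum_runStarts_duplicateAt D i N hi]
  simp [duplicateAt, hD, show ¬ N + 1 ≤ i by omega]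

theorem isPattern_duplicateAt_ascent {D : ℕ → Prop} {i N : ℕ} (k s : ℕ) (hi : i ≤ N)
    (hD : ¬ D i) : IsPattern (N + 1) k s (duplicateAt i D) ↔ IsPattern N k s D := by
  unfold IsPattern
  rw [sum_duplicateAt D i N hi, sum_runStarts_duplicateAt D i N hi]
  simp [duplicateAt, hD, show ¬ N + 1 ≤ i by omega]

theorem sum_doubleDescents_add_runStarts (D : ℕ → Prop) (N : ℕ) :
    ∑ j ∈ range N, (if D j ∧ D (j + 1) then 1 else 0) +
        ∑ j ∈ range (N + 1), (if D j ∧ (j = 0 ∨ ¬ D (j - 1)) then 1 else 0) =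
      ∑ j ∈ range (N + 1), (if D j then 1 else 0) := by
  induction N with
  | zero => simp [-sum_boole]
  | succ N ih =>
    rw [sum_range_succ, sum_range_succ _ (N + 1), sum_range_succ _ (N + 1), ← ih]
    by_cases h : D N <;> by_cases h' : D (N + 1) <;> simp [h, h'] <;> omega

theorem sum_doubleAscents_add (D : ℕ → Prop) (N : ℕ) (h0 : D 0) :
    ∑ j ∈ range N, (if ¬ D j ∧ ¬ D (j + 1) then 1 else 0) +
        ∑ j ∈ range (N + 1), (if D j ∧ (j = 0 ∨ ¬ D (j - 1)) then 1 else 0) +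
        ∑ j ∈ range (N + 1), (if D j then 1 else 0) =
      N + 1 + if D N then 1 else 0 := by
  induction N with
  | zero => simp [-sum_boole, h0]
  | succ N ih =>
    rw [sum_range_succ, sum_range_succ _ (N + 1), sum_range_succ _ (N + 1)]
    by_cases h : D N <;> by_cases h' : D (N + 1) <;> simp [h, h'] at ih ⊢ <;> omega

theorem IsPattern.sum_doubleDescents {N k s : ℕ} {D : ℕ → Prop} (h : IsPattern N k s D) :
    ∑ j ∈ range N, (if D j ∧ D (j + 1) then 1 else 0) = k - s := by
  have := sum_doubleDescents_add_runStarts D N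
  rw [h.2.2.1, h.2.2.2] at this
  omega

theorem IsPattern.sum_doubleAscents {N k s : ℕ} {D : ℕ → Prop} (h : IsPattern (N + 1) k s D) :
    ∑ j ∈ range (N + 1), (if ¬ D j ∧ ¬ D (j + 1) then 1 else 0) = N - s - k := by
  have := sum_doubleAscents_add D (N + 1) h.1
  rw [h.2.2.1, h.2.2.2, if_neg h.2.1] at this
  omega

/-- A sequence avoiding the level `x` with equal endpoints crosses it equally often in both
directions. -/
theorem sum_downCrossings_eq_upCrossings {T : Type*} [LinearOrder T] (e : ℕ → T) (x : T) (N : ℕ)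
    (hx : ∀ j, e j ≠ x) (hN : e N = e 0) :
    ∑ j ∈ range N, (if x < e j ∧ e (j + 1) < x then 1 else 0) =
      ∑ j ∈ range N, (if e j < x ∧ x < e (j + 1) then 1 else 0) := by
  have key : ∀ M, ∑ j ∈ range M, (if x < e j ∧ e (j + 1) < x then 1 else 0) +
      (if x < e M then 1 else 0) =
      ∑ j ∈ range M, (if e j < x ∧ x < e (j + 1) then 1 else 0) +
        if x < e 0 then 1 else 0 := by
    intro M
    induction M with
    | zero => simp
    | succ M ih =>
      rw [sum_range_succ, sum_range_succ]
      rcases lt_or_gt_of_ne (hx M) with h | h <;> rcases lt_or_gt_of_ne (hx (M + 1)) with h' | h' <;>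
        simp [h, h', h.not_gt, h'.not_gt] at ih ⊢ <;> omega
  have := key N
  rw [hN] at this
  omega

end DescentPatterns

section ColoredWords

open Finset Classical

variable {r d m : ℕ}

/-- The colored order on letters: colors are compared first, then values. -/
def letterKey (x : Fin r × Fin d) : ℕ ×ₗ ℕ := toLex (x.1.1, x.2.1)

/-- The extension of a word of letters by a letter of color `0` above all values, both in front of
the word and after it. -/
def extendedWord (w : Fin m → Fin r × Fin d) : ℕ → ℕ ×ₗ ℕ
  | 0 => toLex (0, d)
  | j + 1 => if h : j < m then letterKey (w ⟨j, h⟩) else toLex (0, d)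

/-- The descent pattern of the extended word. -/
def wordDes (w : Fin m → Fin r × Fin d) (j : ℕ) : Prop :=
  extendedWord w (j + 1) < extendedWord w j

theorem extendedWord_insertNth (i : Fin (m + 1)) (x : Fin r × Fin d) (u : Fin m → Fin r × Fin d)
    (j : ℕ) : extendedWord (i.insertNth (α := fun _ => Fin r × Fin d) x u) j =
      if j ≤ i then extendedWord u j else if j = i + 1 then letterKey x
        else extendedWord u (j - 1) := by
  obtain ⟨i, hi⟩ := i
  cases j with
  | zero => simp [extendedWord]
  | succ j =>
    rcases lt_trichotomy j i with h | rfl | h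
    · have e : (⟨j, by omega⟩ : Fin (m + 1)) = (⟨i, hi⟩ : Fin (m + 1)).succAbove ⟨j, by omega⟩ := by
        simp [Fin.succAbove, Fin.lt_def, h]
      simp only [extendedWord, show j < m + 1 by omega, show j < m by omega, dif_pos,
        show j + 1 ≤ i by omega, if_true]
      rw [e, Fin.insertNth_apply_succAbove]
    · simp only [extendedWord, hi, dif_pos, show ¬ j + 1 ≤ j by omega, if_true, if_false]
      rw [Fin.insertNth_apply_same]
    · obtain ⟨j, rfl⟩ : ∃ t, j = t + 1 := ⟨j - 1, by omega⟩
      simp only [show ¬ j + 1 + 1 ≤ i by omega, show j + 1 + 1 ≠ i + 1 by omega, if_false,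
        Nat.add_sub_cancel, extendedWord, Nat.add_lt_add_iff_right]
      split_ifs with hj
      · have e : (⟨j + 1, by omega⟩ : Fin (m + 1)) =
            (⟨i, hi⟩ : Fin (m + 1)).succAbove ⟨j, hj⟩ := by
          simp [Fin.succAbove, Fin.lt_def, show ¬ j < i by omega]
        rw [e, Fin.insertNth_apply_succAbove]
      · rfl

theorem wordDes_insertNth_eq_duplicateAt (i : Fin (m + 1)) (x : Fin r × Fin d)
    (u : Fin m → Fin r × Fin d)
    (h : (letterKey x < extendedWord u i ↔ wordDes u i) ∧
      (extendedWord u (i + 1) < letterKey x ↔ wordDes u i)) :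
    wordDes (i.insertNth (α := fun _ => Fin r × Fin d) x u) = duplicateAt i (wordDes u) := by
  funext j
  apply propext
  rw [wordDes, extendedWord_insertNth, extendedWord_insertNth, duplicateAt]
  rcases lt_trichotomy j i with hj | rfl | hj
  · simp [show j + 1 ≤ i by omega, hj.le, wordDes]
  · simpa using h.1
  · rcases Nat.lt_or_eq_of_le (Nat.succ_le_of_lt hj) with hj' | rfl
    · obtain ⟨j, rfl⟩ : ∃ t, j = t + 1 := ⟨j - 1, by omega⟩
      simp [show ¬ j + 1 + 1 ≤ i by omega, show j + 1 ≠ i by omega, show ¬ j + 1 ≤ i by omega,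
        show j ≠ i by omega, wordDes]
    · simpa using h.2

theorem wordDes_insertNth_self (i : Fin (m + 1)) (x : Fin r × Fin d)
    (u : Fin m → Fin r × Fin d) :
    wordDes (i.insertNth (α := fun _ => Fin r × Fin d) x u) i ↔
      letterKey x < extendedWord u i := by
  simp [wordDes, extendedWord_insertNth]

theorem wordDes_insertNth_succ (i : Fin (m + 1)) (x : Fin r × Fin d)
    (u : Fin m → Fin r × Fin d) :
    wordDes (i.insertNth (α := fun _ => Fin r × Fin d) x u) (i + 1) ↔
      extendedWord u (i + 1) < letterKey x := by
  simp [wordDes, extendedWord_insertNth]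

/-- The letters `x` and `u 0, u 1, …` have pairwise distinct values. -/
def FreshLetter (x : Fin r × Fin d) (u : Fin m → Fin r × Fin d) : Prop :=
  (∀ j, (u j).2 ≠ x.2) ∧ Function.Injective fun j => (u j).2

theorem injective_insertNth_iff (i : Fin (m + 1)) (x : Fin r × Fin d)
    (u : Fin m → Fin r × Fin d) :
    (Function.Injective fun j => (i.insertNth (α := fun _ => Fin r × Fin d) x u j).2) ↔
      FreshLetter x u := by
  simp only [Function.Injective, FreshLetter, Fin.forall_iff_succAbove i,
    Fin.insertNth_apply_same, Fin.insertNth_apply_succAbove, Fin.succAbove_ne, Fin.ne_succAbove,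
    Fin.succAbove_right_inj]
  grind

theorem FreshLetter.extendedWord_ne {x : Fin r × Fin d} {u : Fin m → Fin r × Fin d}
    (h : FreshLetter x u) (j : ℕ) : extendedWord u j ≠ letterKey x := by
  have hd : toLex (0, d) ≠ letterKey x := by
    simp only [letterKey, ne_eq, EmbeddingLike.apply_eq_iff_eq, Prod.mk.injEq, not_and]
    have := x.2.2
    omega
  cases j with
  | zero => exact hd
  | succ j =>
    rw [extendedWord]
    split_ifs with hj
    · intro e
      simp only [letterKey, EmbeddingLike.apply_eq_iff_eq, Prod.mk.injEq] at e
      exact h.1 ⟨j, hj⟩ (Fin.ext e.2)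
    · exact hd

/-- Words with distinct values whose extended descent pattern has `k + 1` descents
and `s + 1` slides. -/
def IsWord (k s : ℕ) (w : Fin m → Fin r × Fin d) : Prop :=
  (Function.Injective fun j => (w j).2) ∧ IsPattern m k s (wordDes w)

theorem isWord_insertNth_descent (k s : ℕ) (i : Fin (m + 1)) (x : Fin r × Fin d)
    (u : Fin m → Fin r × Fin d) :
    let w := i.insertNth (α := fun _ => Fin r × Fin d) x u
    (IsWord (k + 1) s w ∧ wordDes w i ∧ wordDes w (i + 1)) ↔
      (FreshLetter x u ∧ IsPattern m k s (wordDes u)) ∧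
        letterKey x < extendedWord u i ∧ extendedWord u (i + 1) < letterKey x := by
  simp only [IsWord, injective_insertNth_iff, wordDes_insertNth_self, wordDes_insertNth_succ]
  refine and_congr_left fun h => and_congr_right fun _ => ?_
  have hD : wordDes u i := h.2.trans h.1
  rw [wordDes_insertNth_eq_duplicateAt i x u (by simp [h, hD])]
  exact isPattern_duplicateAt_descent k s (by omega) hD

theorem isWord_insertNth_ascent (k s : ℕ) (i : Fin (m + 1)) (x : Fin r × Fin d)
    (u : Fin m → Fin r × Fin d) :
    let w := i.insertNth (α := fun _ => Fin r × Fin d) x u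
    (IsWord k s w ∧ ¬ wordDes w i ∧ ¬ wordDes w (i + 1)) ↔
      (FreshLetter x u ∧ IsPattern m k s (wordDes u)) ∧
        extendedWord u i < letterKey x ∧ letterKey x < extendedWord u (i + 1) := by
  simp only [IsWord, injective_insertNth_iff, wordDes_insertNth_self, wordDes_insertNth_succ,
    and_assoc]
  refine and_congr_right fun hF => ?_
  rw [not_lt, not_lt, (hF.extendedWord_ne i).le_iff_lt, (hF.extendedWord_ne (i + 1)).symm.le_iff_lt]
  refine and_congr_left fun h => ?_
  have hD : ¬ wordDes u i := (h.1.trans h.2).not_gt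
  rw [wordDes_insertNth_eq_duplicateAt i x u (by simp [h.1.not_gt, h.2.not_gt, hD])]
  exact isPattern_duplicateAt_ascent k s (by omega) hD

theorem sum_word_position_eq {α : Type*} [Fintype α] (P : (Fin (m + 1) → α) → ℕ → Prop)
    (Q : α → (Fin m → α) → Prop) (R : α → (Fin m → α) → ℕ → Prop)
    [∀ w i, Decidable (P w i)] [∀ x u i, Decidable (R x u i)]
    (h : ∀ (i : Fin (m + 1)) x u,
      P (i.insertNth (α := fun _ => α) x u) i ↔ Q x u ∧ R x u i) :
    ∑ w, ∑ i ∈ range (m + 1), (if P w i then 1 else 0) =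
      ∑ p : α × (Fin m → α), if Q p.1 p.2 then
        ∑ i ∈ range (m + 1), (if R p.1 p.2 i then 1 else 0) else 0 := by
  simp only [sum_range]
  rw [sum_comm]
  have : ∀ i : Fin (m + 1), ∑ w, (if P w i then 1 else 0) =
      ∑ p : α × (Fin m → α), if Q p.1 p.2 ∧ R p.1 p.2 i then 1 else 0 := fun i => by
    rw [← (Fin.insertNthEquiv (fun _ => α) i).sum_comp]
    simp [Fin.insertNthEquiv, h]
  simp only [this]
  rw [sum_comm]
  refine sum_congr rfl fun p _ => ?_
  by_cases hQ : Q p.1 p.2 <;> simp [hQ]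

theorem card_isWord_mul_sum {k s c : ℕ} (R : (Fin m → Fin r × Fin d) → ℕ → Prop)
    [∀ w j, Decidable (R w j)] (N : ℕ)
    (h : ∀ w, IsWord k s w → ∑ j ∈ range N, (if R w j then 1 else 0) = c) :
    ∑ w : Fin m → Fin r × Fin d, ∑ i ∈ range N, (if IsWord k s w ∧ R w i then 1 else 0) =
      Nat.card {w : Fin m → Fin r × Fin d // IsWord k s w} * c := by
  rw [Nat.card_eq_fintype_card, Fintype.card_subtype, ← smul_eq_mul, ← sum_const, sum_filter]
  refine sum_congr rfl fun w _ => ?_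
  by_cases hw : IsWord k s w
  · simpa only [hw, true_and, if_true] using h w hw
  · simp [hw]

theorem card_isWord_succ_mul (k s : ℕ) :
    Nat.card {w : Fin (m + 1) → Fin r × Fin d // IsWord (k + 1) s w} * (k + 1 - s) =
      Nat.card {w : Fin (m + 1) → Fin r × Fin d // IsWord k s w} * (m - s - k) := by
  rw [← card_isWord_mul_sum (fun w i => wordDes w i ∧ wordDes w (i + 1)) (m + 1)
      fun w hw => hw.2.sum_doubleDescents,
    ← card_isWord_mul_sum (fun w i => ¬ wordDes w i ∧ ¬ wordDes w (i + 1)) (m + 1)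
      fun w hw => hw.2.sum_doubleAscents,
    sum_word_position_eq (fun w i => IsWord (k + 1) s w ∧ wordDes w i ∧ wordDes w (i + 1))
      (fun x u => FreshLetter x u ∧ IsPattern m k s (wordDes u))
      (fun x u i => letterKey x < extendedWord u i ∧ extendedWord u (i + 1) < letterKey x)
      (isWord_insertNth_descent k s),
    sum_word_position_eq (fun w i => IsWord k s w ∧ ¬ wordDes w i ∧ ¬ wordDes w (i + 1))
      (fun x u => FreshLetter x u ∧ IsPattern m k s (wordDes u))
      (fun x u i => extendedWord u i < letterKey x ∧ letterKey x < extendedWord u (i + 1))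
      (isWord_insertNth_ascent k s)]
  refine sum_congr rfl fun p _ => ?_
  split_ifs with hp
  · exact sum_downCrossings_eq_upCrossings _ _ _ hp.1.extendedWord_ne (by simp [extendedWord])
  · rfl

theorem card_isWord (s j : ℕ) :
    Nat.card {w : Fin (m + 1) → Fin r × Fin d // IsWord (s + j) s w} =
      Nat.choose (m - 2 * s) j * Nat.card {w : Fin (m + 1) → Fin r × Fin d // IsWord s s w} := by
  induction j with
  | zero => simp
  | succ j ih =>
    have h := card_isWord_succ_mul (r := r) (d := d) (m := m) (s + j) s
    rw [ih, show s + j + 1 - s = j + 1 by omega,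
      show m - s - (s + j) = m - 2 * s - j by omega] at h
    have hc := Nat.choose_succ_right_eq (m - 2 * s) j
    apply Nat.eq_of_mul_eq_mul_right (Nat.succ_pos j)
    rw [Nat.succ_eq_add_one, ← add_assoc, h, mul_right_comm, ← hc]
    ring

end ColoredWords

section Translation

open Finset Classical

variable {r n : ℕ}

/-- The word of letters of a colored permutation. -/
def letterWord (σ : Fin (n + 1) → Fin (n + 1)) (ε : Fin (n + 1) → Fin r) :
    Fin (n + 1) → Fin r × Fin (n + 1) := fun i => (ε i, σ i)

theorem extDes_iff_wordDes (σ : Fin (n + 1) → Fin (n + 1)) (ε : Fin (n + 1) → Fin r) (i : ℕ)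
    (hi : i ≤ n + 1) : extDes (n + 1) r σ ε i ↔ wordDes (letterWord σ ε) i := by
  cases i with
  | zero =>
    have e : ∀ t : Fin (n + 1), t.1 = 0 ↔ t = 0 := fun t => Fin.val_eq_zero_iff
    have h0 := (σ 0).2
    simp [extDes, wordDes, extendedWord, letterWord, letterKey, Prod.Lex.toLex_lt_toLex, e]
    omega
  | succ i =>
    simp only [extDes, wordDes, extendedWord, letterWord, letterKey, Nat.succ_ne_zero, if_false,
      show i < n + 1 by omega, dif_pos, Nat.add_sub_cancel]
    rcases Nat.lt_or_eq_of_le hi with h | h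
    · simp only [h, dif_pos, Prod.Lex.toLex_lt_toLex, Fin.lt_def, Fin.ext_iff]
      rw [eq_comm (a := (ε ⟨i, _⟩ : ℕ))]
    · obtain rfl : i = n := by omega
      have e : ∀ t : Fin (i + 1), t.1 = i ↔ t = Fin.last i := fun t => by simp [Fin.ext_iff]
      change _ ↔ (dite _ _ _) < toLex ((ε (Fin.last i) : ℕ), (σ (Fin.last i) : ℕ))
      simp [Prod.Lex.toLex_lt_toLex, e]

theorem colDes_eq_sum (σ : Fin (n + 1) → Fin (n + 1)) (ε : Fin (n + 1) → Fin r) :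
    colDes (n + 1) r σ ε =
      ∑ j ∈ range (n + 1), (if wordDes (letterWord σ ε) (j + 1) then 1 else 0) := by
  rw [colDes, Nat.card_eq_fintype_card, Fintype.card_subtype, card_filter, sum_range]
  refine sum_congr rfl fun i _ => if_congr ?_ rfl rfl
  rw [← extDes_iff_wordDes _ _ _ (by omega)]
  simp only [extDes, Nat.succ_ne_zero, if_false, Nat.add_sub_cancel]
  split_ifs with h h'
  · rfl
  · constructor
    · intro h2 t ht
      obtain rfl : t = i := Fin.ext (by omega)
      exact h2
    · intro h2
      exact h2 i (by omega)
  · omega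

theorem slideCount_eq_sum (σ : Fin (n + 1) → Fin (n + 1)) (ε : Fin (n + 1) → Fin r) :
    slideCount (n + 1) r σ ε =
      ∑ j ∈ range (n + 1 + 1), (if wordDes (letterWord σ ε) j ∧
        (j = 0 ∨ ¬ wordDes (letterWord σ ε) (j - 1)) then 1 else 0) := by
  rw [slideCount, ← card_filter]
  refine Nat.subtype_card _ fun i => ?_
  rw [mem_filter, mem_range, Nat.lt_succ_iff]
  refine and_congr_right fun hi => ?_
  rw [extDes_iff_wordDes _ _ _ hi, extDes_iff_wordDes _ _ _ (by omega)]

theorem aColored0_eq_card_isWord (k s : ℕ) :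
    aColored0 r (n + 1) k s =
      Nat.card {w : Fin (n + 1) → Fin r × Fin (n + 1) // IsWord k s w} := by
  refine Nat.card_congr (((Equiv.prodComm _ _).trans
    (Equiv.arrowProdEquivProdArrow _ _ _).symm).subtypeEquiv fun p => ?_)
  obtain ⟨σ, ε⟩ := p
  change _ ↔ (Function.Injective σ ∧ IsPattern (n + 1) k s (wordDes (letterWord σ ε)))
  have h0 : (∀ i : Fin (n + 1), i.1 = 0 → (ε i : ℕ) = 0) ↔ wordDes (letterWord σ ε) 0 := by
    rw [← extDes_iff_wordDes _ _ _ (by omega)]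
    simp [extDes]
  have hd : (∀ i : Fin (n + 1), i.1 = n + 1 - 1 → (ε i : ℕ) = 0) ↔
      ¬ wordDes (letterWord σ ε) (n + 1) := by
    rw [← extDes_iff_wordDes _ _ _ le_rfl]
    have e : ∀ t : Fin (n + 1), t.1 = n ↔ t = Fin.last n := fun t => by simp [Fin.ext_iff]
    simp [extDes, e]
  rw [IsPattern, Finite.injective_iff_bijective, h0, hd, colDes_eq_sum, slideCount_eq_sum,
    sum_range_succ' (fun j => if wordDes (letterWord σ ε) j then 1 else 0) (n + 1)]
  refine and_congr_right fun _ => and_congr_right fun h => ?_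
  rw [if_pos h, Nat.add_right_cancel_iff]

end Translation

theorem slide_descent_identity (d r k s : ℕ) (hd : 1 ≤ d) (hr : 1 ≤ r) (hsk : s ≤ k) :
    aColored0 r d k s = Nat.choose (d - 1 - 2 * s) (k - s) * aColored0 r d s s := by
  obtain ⟨n, rfl⟩ : ∃ n, d = n + 1 := ⟨d - 1, by omega⟩
  obtain ⟨j, rfl⟩ := Nat.exists_eq_add_of_le hsk
  rw [aColored0_eq_card_isWord, aColored0_eq_card_isWord, card_isWord, Nat.add_sub_cancel,
    Nat.add_sub_cancel_left]
end

section
/- Gamma-positivity of A_d^{(0)}: the symmetric polynomial A_d^{(0)}(t) = ∑_σ t^{des(σ)} (sum over r-colored permutations of [d] with ε_1 = ε_d = 0) satisfies A_d^{(0)}(t) = ∑_{i=0}^{⌊(d−1)/2⌋} a^{(0)}(d, i, i) t^i (1+t)^{d−1−2i}, where a^{(0)}(d, i, i) is the number of such colored permutations with exactly i descents and i+1 slides; in particular all gamma-coefficients are nonnegative. -/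
/-- Coefficient of t^m in A_d^{(0)}(t). -/
noncomputable def countDes0 (r d m : ℕ) : ℕ :=
  Nat.card {p : (Fin d → Fin d) × (Fin d → Fin r) //
    Function.Bijective p.1 ∧
    (∀ i : Fin d, i.1 = 0 → (p.2 i : ℕ) = 0) ∧
    (∀ i : Fin d, i.1 = d - 1 → (p.2 i : ℕ) = 0) ∧
    colDes d r p.1 p.2 = m}

namespace ColoredWord

open Polynomial

/-- The extended word of a colored permutation, coded by natural numbers in a way which respects
the colored order; both boundary letters are coded by `d`. -/
def letter {d r : ℕ} (p : (Fin d → Fin d) × (Fin d → Fin r)) : ℕ → ℕ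
  | 0 => d
  | j + 1 => if h : j < d then (p.2 ⟨j, h⟩ : ℕ) * (d + 1) + p.1 ⟨j, h⟩ else d

/-- Descents of a sequence. -/
def IsDescent (g : ℕ → ℕ) (j : ℕ) : Prop := g (j + 1) < g j

/-- `y` lies farther away from `c` than `x`, on the same side. -/
def Beyond (c x y : ℕ) : Prop := (x < c ∧ y < x) ∨ (c < x ∧ x < y)

/-- The interval `[l + 1, m + 1]` is the maximal one around position `k + 1` all of whose other
letters are beyond `g (k + 1)`. -/
structure IsBlock (c : ℕ) (g : ℕ → ℕ) (k l m : ℕ) : Prop where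
  left_le : l ≤ k
  le_right : k ≤ m
  inside : ∀ j, l ≤ j → j ≤ m → j ≠ k → Beyond c (g (k + 1)) (g (j + 1))
  left : ¬ Beyond c (g (k + 1)) (g l)
  right : ¬ Beyond c (g (k + 1)) (g (m + 2))

/-- The rearrangement of positions exchanging the parts of `[l, m]` before and after `k`. -/
def swapParts (k l m j : ℕ) : ℕ :=
  if l ≤ j ∧ j ≤ m then
    if j < l + m - k then j + (k + 1 - l) else if j = l + m - k then k else j - (m + 1 - k)
  else j

theorem swapParts_swapParts {k l m : ℕ} (h₁ : l ≤ k) (h₂ : k ≤ m) (j : ℕ) :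
    swapParts k l m (swapParts (l + m - k) l m j) = j := by
  unfold swapParts
  split_ifs <;> omega

theorem swapParts_lt {k l m d : ℕ} (h₁ : l ≤ k) (h₂ : k ≤ m) (h₃ : m < d) {j : ℕ} (hj : j < d) :
    swapParts k l m j < d := by
  unfold swapParts
  split_ifs <;> omega

namespace IsBlock

theorem unique {c : ℕ} {g : ℕ → ℕ} {k l m l' m' : ℕ} (h : IsBlock c g k l m)
    (h' : IsBlock c g k l' m') : l = l' ∧ m = m' := by
  obtain ⟨a1, a2, a3, a4, a5⟩ := h
  obtain ⟨b1, b2, b3, b4, b5⟩ := h'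
  constructor
  · rcases lt_trichotomy l l' with h | h | h
    · have := a3 (l' - 1) (by omega) (by omega) (by omega)
      rw [show l' - 1 + 1 = l' by omega] at this
      exact absurd this b4
    · exact h
    · have := b3 (l - 1) (by omega) (by omega) (by omega)
      rw [show l - 1 + 1 = l by omega] at this
      exact absurd this a4
  · rcases lt_trichotomy m m' with h | h | h
    · exact absurd (b3 (m + 1) (by omega) (by omega) (by omega)) a5
    · exact h
    · exact absurd (a3 (m' + 1) (by omega) (by omega) (by omega)) b5

theorem exists_of_boundary {c : ℕ} {g : ℕ → ℕ} {d k : ℕ} (hk : k < d) (h0 : g 0 = c)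
    (h1 : g (d + 1) = c) : ∃ l m, m < d ∧ IsBlock c g k l m := by
  classical
  have b0 : ¬ Beyond c (g (k + 1)) c := by unfold Beyond; omega
  have hL : ∃ n, ¬ (n < k ∧ Beyond c (g (k + 1)) (g (k - n))) := ⟨k, by simp⟩
  have hR : ∃ n, ¬ Beyond c (g (k + 1)) (g (k + n + 2)) :=
    ⟨d - 1 - k, by rw [show k + (d - 1 - k) + 2 = d + 1 by omega, h1]; exact b0⟩
  have hLs := Nat.find_spec hL
  have hLm := fun n => @Nat.find_min _ _ hL n
  have hLle : Nat.find hL ≤ k := Nat.find_min' hL (by simp)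
  have hRs := Nat.find_spec hR
  have hRm := fun n => @Nat.find_min _ _ hR n
  have hRle : Nat.find hR ≤ d - 1 - k := Nat.find_min' hR
    (by rw [show k + (d - 1 - k) + 2 = d + 1 by omega, h1]; exact b0)
  refine ⟨k - Nat.find hL, k + Nat.find hR, by omega, by omega, by omega, ?_, ?_, hRs⟩
  · intro j h₁ h₂ h₃
    rcases lt_or_gt_of_ne h₃ with h | h
    · have := hLm (k - (j + 1)) (by omega)
      rw [not_not] at this
      rw [show k - (k - (j + 1)) = j + 1 by omega] at this
      exact this.2
    · have := hRm (j - (k + 1)) (by omega)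
      rw [not_not] at this
      rwa [show k + (j - (k + 1)) + 2 = j + 1 by omega] at this
  · rcases lt_or_eq_of_le hLle with h | h
    · exact fun hb => hLs ⟨h, hb⟩
    · rw [h, Nat.sub_self, h0]
      exact b0

variable {c k l m : ℕ} {g g' : ℕ → ℕ}

theorem descents (h : IsBlock c g k l m) (hc : g (k + 1) ≠ c)
    (hne : ∀ j, j ≠ k + 1 → g j ≠ g (k + 1)) :
    (IsDescent g l ↔ g (k + 1) < c) ∧ (IsDescent g (m + 1) ↔ ¬ g (k + 1) < c) ∧
      (l < k → (IsDescent g k ↔ ¬ g (k + 1) < c)) ∧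
      (k < m → (IsDescent g (k + 1) ↔ g (k + 1) < c)) := by
  obtain ⟨a1, a2, a3, a4, a5⟩ := h
  have hl := hne l (by omega)
  have hm := hne (m + 2) (by omega)
  unfold Beyond at a3 a4 a5
  unfold IsDescent
  refine ⟨?_, ?_, ?_, ?_⟩
  · rcases eq_or_ne l k with rfl | h
    · omega
    · have := a3 l le_rfl (by omega) h
      omega
  · rcases eq_or_ne m k with rfl | h
    · change g (m + 2) < g (m + 1) ↔ _
      omega
    · have := a3 m (by omega) le_rfl h
      change g (m + 2) < g (m + 1) ↔ _
      omega
  · intro h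
    have := a3 (k - 1) (by omega) (by omega) (by omega)
    rw [show k - 1 + 1 = k by omega] at this
    omega
  · intro h
    have := a3 (k + 1) (by omega) (by omega) (by omega)
    omega

theorem swap (h : IsBlock c g k l m) (h0 : g' 0 = g 0)
    (hg : ∀ j, g' (j + 1) = g (swapParts k l m j + 1)) : IsBlock c g' (l + m - k) l m := by
  obtain ⟨a1, a2, a3, a4, a5⟩ := h
  have hk : g' (l + m - k + 1) = g (k + 1) := by
    rw [hg]; congr 2; unfold swapParts; split_ifs <;> omega
  refine ⟨by omega, by omega, ?_, ?_, ?_⟩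
  · intro j h₁ h₂ h₃
    rw [hk, hg]
    apply a3 <;> unfold swapParts <;> split_ifs <;> omega
  · rw [hk]
    convert a4 using 2
    rcases l with _ | l
    · exact h0
    · rw [hg]; congr 2; unfold swapParts; split_ifs <;> omega
  · rw [hk]
    convert a5 using 2
    rw [show m + 2 = m + 1 + 1 from rfl, hg]
    congr 2; unfold swapParts; split_ifs <;> omega

theorem ne_swap (h : IsBlock c g k l m) (hne : ∀ j, j ≠ k + 1 → g j ≠ g (k + 1))
    (h0 : g' 0 = g 0) (hg : ∀ j, g' (j + 1) = g (swapParts k l m j + 1)) (j : ℕ)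
    (hj : j ≠ l + m - k + 1) : g' j ≠ g' (l + m - k + 1) := by
  obtain ⟨a1, a2, -, -, -⟩ := h
  have hk : g' (l + m - k + 1) = g (k + 1) := by
    rw [hg]; congr 2; unfold swapParts; split_ifs <;> omega
  rw [hk]
  rcases j with _ | j
  · rw [h0]; exact hne 0 (by omega)
  · rw [hg]
    apply hne
    unfold swapParts; split_ifs <;> omega

/-- Exchanging the two parts of a block keeps the descents around all letters other than the
central one, and those around the central one are either kept or both reversed. -/
theorem descents_swap (h : IsBlock c g k l m) (hc : g (k + 1) ≠ c)
    (hne : ∀ j, j ≠ k + 1 → g j ≠ g (k + 1)) (h0 : g' 0 = g 0)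
    (hg : ∀ j, g' (j + 1) = g (swapParts k l m j + 1)) :
    (∀ j, j ≠ l + m - k →
      ((IsDescent g' j ↔ IsDescent g (swapParts k l m j)) ∧
        (IsDescent g' (j + 1) ↔ IsDescent g (swapParts k l m j + 1)))) ∧
    ((¬ (IsDescent g k ↔ IsDescent g (k + 1)) ∧
        (IsDescent g' (l + m - k) ↔ IsDescent g k) ∧
        (IsDescent g' (l + m - k + 1) ↔ IsDescent g (k + 1))) ∨
      ((IsDescent g k ↔ IsDescent g (k + 1)) ∧
        (IsDescent g' (l + m - k) ↔ ¬ IsDescent g k) ∧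
        (IsDescent g' (l + m - k + 1) ↔ ¬ IsDescent g (k + 1)))) := by
  have hk : g' (l + m - k + 1) = g (k + 1) := by
    have := h.left_le
    have := h.le_right
    rw [hg]; congr 2; unfold swapParts; split_ifs <;> omega
  obtain ⟨d1, d2, d3, d4⟩ := h.descents hc hne
  obtain ⟨e1, e2, e3, e4⟩ := (h.swap h0 hg).descents (by rwa [hk]) (h.ne_swap hne h0 hg)
  rw [hk] at e1 e2 e3 e4
  have a1 := h.left_le
  have a2 := h.le_right
  have pure_gap : ∀ j i, (j = 0 ∧ i = 0 ∨ ∃ j', j = j' + 1 ∧ i = swapParts k l m j' + 1) →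
      swapParts k l m j = i → (IsDescent g' j ↔ IsDescent g i) := by
    rintro j i (⟨rfl, rfl⟩ | ⟨j', rfl, rfl⟩) hi
    · unfold IsDescent; rw [h0, hg, hi]
    · unfold IsDescent; rw [hg, hg, hi]
  constructor
  · intro j hj
    constructor
    · by_cases h₁ : j = l
      · subst h₁
        have hs : swapParts k j m j = k + 1 := by unfold swapParts; split_ifs <;> omega
        rw [hs, e1, d4 (by omega)]
      by_cases h₂ : j = m + 1
      · subst h₂
        have hs : swapParts k l m (m + 1) = m + 1 := by unfold swapParts; split_ifs <;> omega
        rw [hs, e2, d2]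
      by_cases h₃ : j = l + m - k + 1
      · have hs : swapParts k l m j = l := by unfold swapParts; split_ifs <;> omega
        rw [hs, d1, h₃, e4 (by omega)]
      · apply pure_gap _ _ _ rfl
        rcases j with _ | j
        · left; refine ⟨rfl, ?_⟩; unfold swapParts; split_ifs <;> omega
        · right; refine ⟨j, rfl, ?_⟩; unfold swapParts; split_ifs <;> omega
    · by_cases h₁ : j + 1 = l
      · have hs : swapParts k l m j + 1 = l := by unfold swapParts; split_ifs <;> omega
        rw [hs, h₁, e1, d1]
      by_cases h₂ : j = m
      · subst h₂
        have hs : swapParts k l j j + 1 = k := by unfold swapParts; split_ifs <;> omega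
        rw [hs, e2, d3 (by omega)]
      by_cases h₃ : j + 1 = l + m - k
      · by_cases h₄ : l ≤ j
        · have hs : swapParts k l m j + 1 = m + 1 := by unfold swapParts; split_ifs <;> omega
          rw [hs, d2, h₃, e3 (by omega)]
        · omega
      · refine pure_gap _ _ (Or.inr ⟨j, rfl, rfl⟩) ?_
        unfold swapParts; split_ifs <;> omega
  · rcases eq_or_lt_of_le a1 with h₁ | h₁ <;> rcases eq_or_lt_of_le a2 with h₂ | h₂
    · left
      have : l + m - k = k := by omega
      rw [this] at e3 e4 ⊢
      subst h₁ h₂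
      exact ⟨by rw [d1, d2]; exact iff_not_self, by rw [e1, d1], by rw [e2, d2]⟩
    · right
      have : l + m - k = m := by omega
      rw [this] at e3 e4 ⊢
      subst h₁
      rw [e2, e3 h₂, d1, d4 h₂]
      simp
    · right
      have : l + m - k = l := by omega
      rw [this] at e3 e4 ⊢
      subst h₂
      rw [e1, e4 h₁, d2, d3 h₁]
      simp
    · left
      exact ⟨by rw [d3 h₁, d4 h₂]; exact not_iff_self, by rw [e3 (by omega), d3 h₁],
        by rw [e4 (by omega), d4 h₂]⟩

end IsBlock

section Hop

variable {d r : ℕ}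

/-- Precomposition of a colored permutation with a map of positions. -/
def reindex (p : (Fin d → Fin d) × (Fin d → Fin r)) (f : Fin d → Fin d) :
    (Fin d → Fin d) × (Fin d → Fin r) := (p.1 ∘ f, p.2 ∘ f)

/-- `swapParts` as a permutation of `Fin d`. -/
def swapPerm {k l m : ℕ} (h₁ : l ≤ k) (h₂ : k ≤ m) (h₃ : m < d) : Equiv.Perm (Fin d) where
  toFun i := ⟨swapParts k l m i, swapParts_lt h₁ h₂ h₃ i.2⟩
  invFun i := ⟨swapParts (l + m - k) l m i, swapParts_lt (by omega) (by omega) h₃ i.2⟩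
  left_inv i := by
    ext
    have := swapParts_swapParts (k := l + m - k) (l := l) (m := m) (by omega) (by omega) i
    rwa [show l + m - (l + m - k) = k by omega] at this
  right_inv i := by
    ext
    exact swapParts_swapParts h₁ h₂ i

theorem letter_succ (p : (Fin d → Fin d) × (Fin d → Fin r)) (i : Fin d) :
    letter p (i + 1) = (p.2 i : ℕ) * (d + 1) + p.1 i := by
  simp [letter]

theorem letter_succ_ne (p : (Fin d → Fin d) × (Fin d → Fin r)) (i : Fin d) :
    letter p (i + 1) ≠ d := by
  rw [letter_succ]
  intro h
  have h₁ := (p.1 i).2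
  rcases Nat.eq_zero_or_pos (p.2 i : ℕ) with h₂ | h₂
  · rw [h₂] at h; omega
  · nlinarith

theorem letter_ne {p : (Fin d → Fin d) × (Fin d → Fin r)} (hp : Function.Injective p.1) (i : Fin d)
    (j : ℕ) (hj : j ≠ i + 1) : letter p j ≠ letter p (i + 1) := by
  rcases j with _ | j
  · exact (letter_succ_ne p i).symm
  · by_cases h : j < d
    · intro he
      rw [letter_succ, letter_succ p ⟨j, h⟩] at he
      have h₁ := (p.1 i).2
      have h₂ := (p.1 ⟨j, h⟩).2
      have he' := congrArg (· % (d + 1)) he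
      simp only [Nat.mul_add_mod_self_right] at he'
      rw [Nat.mod_eq_of_lt (by omega), Nat.mod_eq_of_lt (by omega)] at he'
      have := hp (Fin.ext he')
      apply hj
      rw [← this]
    · have : letter p (j + 1) = d := by simp [letter, h]
      rw [this]
      exact (letter_succ_ne p i).symm

theorem letter_reindex {k l m : ℕ} (h₁ : l ≤ k) (h₂ : k ≤ m) (h₃ : m < d)
    (p : (Fin d → Fin d) × (Fin d → Fin r)) (j : ℕ) :
    letter (reindex p (swapPerm h₁ h₂ h₃)) (j + 1) = letter p (swapParts k l m j + 1) := by
  by_cases h : j < d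
  · have := swapParts_lt h₁ h₂ h₃ h
    simp [letter, h, this, reindex, swapPerm]
  · have hs : swapParts k l m j = j := by unfold swapParts; split_ifs <;> omega
    rw [hs]
    simp [letter, h]

/-- Colored permutations whose first and last colors vanish, as a condition on descents. -/
def Admissible (p : (Fin d → Fin d) × (Fin d → Fin r)) : Prop :=
  Function.Bijective p.1 ∧ IsDescent (letter p) 0 ∧ ¬ IsDescent (letter p) d

/-- `q` arises from `p` by exchanging the two parts of the block around the letter of value `v`. -/
def IsHop (v : Fin d) (p q : (Fin d → Fin d) × (Fin d → Fin r)) : Prop :=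
  ∃ (k : Fin d) (l m : ℕ) (hm : m < d) (h : IsBlock d (letter p) k l m),
    p.1 k = v ∧ q = reindex p (swapPerm h.left_le h.le_right hm)

theorem exists_isHop (v : Fin d) {p : (Fin d → Fin d) × (Fin d → Fin r)}
    (hp : Function.Bijective p.1) : ∃ q, IsHop v p q := by
  obtain ⟨k, hk⟩ := hp.2 v
  obtain ⟨l, m, hm, h⟩ := IsBlock.exists_of_boundary (g := letter p) k.2 rfl (by simp [letter])
  exact ⟨_, k, l, m, hm, h, hk, rfl⟩

theorem IsHop.unique {v : Fin d} {p q q' : (Fin d → Fin d) × (Fin d → Fin r)}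
    (hp : Function.Injective p.1) (h : IsHop v p q) (h' : IsHop v p q') : q = q' := by
  obtain ⟨k, l, m, hm, hb, hk, rfl⟩ := h
  obtain ⟨k', l', m', hm', hb', hk', rfl⟩ := h'
  obtain rfl : k = k' := hp (hk.trans hk'.symm)
  obtain ⟨rfl, rfl⟩ := hb.unique hb'
  rfl

theorem IsHop.symm {v : Fin d} {p q : (Fin d → Fin d) × (Fin d → Fin r)}
    (h : IsHop v p q) : IsHop v q p := by
  obtain ⟨k, l, m, hm, hb, hk, rfl⟩ := h
  have h₁ := hb.left_le
  have h₂ := hb.le_right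
  refine ⟨⟨l + m - k, by omega⟩, l, m, hm,
    hb.swap rfl (letter_reindex h₁ h₂ hm p), ?_, ?_⟩
  · refine Eq.trans ?_ hk
    refine congrArg p.1 (Fin.ext ?_)
    change swapParts k l m (l + m - k) = k
    unfold swapParts; split_ifs <;> omega
  · have : ∀ i, swapPerm h₁ h₂ hm (swapPerm (k := l + m - k) (l := l) (m := m)
        (by omega) (by omega) hm i) = i := by
      intro i
      ext
      exact swapParts_swapParts h₁ h₂ i
    refine Prod.ext ?_ ?_ <;> funext i <;> simp [reindex, this]

theorem IsHop.exists_perm {v : Fin d} {p q : (Fin d → Fin d) × (Fin d → Fin r)}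
    (hp : Function.Injective p.1) (h : IsHop v p q) :
    ∃ π : Equiv.Perm (Fin d), q = reindex p π ∧
      (∀ j, p.1 (π j) ≠ v →
        ((IsDescent (letter q) j ↔ IsDescent (letter p) (π j)) ∧
          (IsDescent (letter q) (j + 1) ↔ IsDescent (letter p) (π j + 1)))) ∧
      (∀ j, p.1 (π j) = v →
        ((¬ (IsDescent (letter p) (π j) ↔ IsDescent (letter p) (π j + 1)) ∧
          (IsDescent (letter q) j ↔ IsDescent (letter p) (π j)) ∧
          (IsDescent (letter q) (j + 1) ↔ IsDescent (letter p) (π j + 1))) ∨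
        ((IsDescent (letter p) (π j) ↔ IsDescent (letter p) (π j + 1)) ∧
          (IsDescent (letter q) j ↔ ¬ IsDescent (letter p) (π j)) ∧
          (IsDescent (letter q) (j + 1) ↔ ¬ IsDescent (letter p) (π j + 1))))) := by
  obtain ⟨k, l, m, hm, hb, hk, rfl⟩ := h
  have h₁ := hb.left_le
  have h₂ := hb.le_right
  obtain ⟨hoff, hat⟩ := hb.descents_swap
    (g' := letter (reindex p (swapPerm h₁ h₂ hm))) (letter_succ_ne p k) (letter_ne hp k) rfl
    (letter_reindex h₁ h₂ hm p)
  refine ⟨swapPerm h₁ h₂ hm, rfl, ?_, ?_⟩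
  · intro j hj
    apply hoff
    intro he
    apply hj
    refine Eq.trans (congrArg p.1 (Fin.ext ?_)) hk
    change swapParts k l m j = k
    unfold swapParts; split_ifs <;> omega
  · intro j hj
    have hjk := congrArg Fin.val (hp (hj.trans hk.symm))
    have hj' : (j : ℕ) = l + m - k := by
      simp only [swapPerm, Equiv.coe_fn_mk] at hjk
      unfold swapParts at hjk
      split_ifs at hjk <;> omega
    rw [hjk, hj']
    exact hat

theorem IsHop.admissible {v : Fin d} {p q : (Fin d → Fin d) × (Fin d → Fin r)}
    (hp : Admissible p) (h : IsHop v p q) : Admissible q := by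
  obtain ⟨hb, hf, hl⟩ := hp
  obtain ⟨k, l, m, hm, hblk, hk, rfl⟩ := h
  have h₁ := hblk.left_le
  have h₂ := hblk.le_right
  have hg := letter_reindex h₁ h₂ hm p
  have hk' : letter (reindex p (swapPerm h₁ h₂ hm)) (l + m - k + 1) = letter p (k + 1) := by
    rw [hg]; congr 2; unfold swapParts; split_ifs <;> omega
  obtain ⟨d1, d2, -, -⟩ := hblk.descents (letter_succ_ne p k) (letter_ne hb.1 k)
  obtain ⟨e1, e2, -, -⟩ := (hblk.swap (g' := letter (reindex p (swapPerm h₁ h₂ hm))) rfl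
    hg).descents (by rw [hk']; exact letter_succ_ne p k) (hblk.ne_swap (letter_ne hb.1 k) rfl hg)
  rw [hk'] at e1 e2
  refine ⟨hb.comp (swapPerm h₁ h₂ hm).bijective, ?_, ?_⟩
  · rcases Nat.eq_zero_or_pos l with rfl | h
    · rwa [e1, ← d1]
    · unfold IsDescent at hf ⊢
      rw [hg]
      rwa [show swapParts k l m 0 = 0 by unfold swapParts; split_ifs <;> omega]
  · rcases eq_or_ne d (m + 1) with h | h
    · rw [← h] at d2 e2
      rwa [e2, ← d2]
    · unfold IsDescent at hl ⊢
      obtain ⟨e, rfl⟩ : ∃ e, d = e + 1 := ⟨d - 1, by omega⟩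
      rw [hg, hg]
      rwa [show swapParts k l m (e + 1) = e + 1 by unfold swapParts; split_ifs <;> omega,
        show swapParts k l m e = e by unfold swapParts; split_ifs <;> omega]

end Hop

section Weight

variable {d r : ℕ}

open Classical in
/-- The weight of a letter preceded by a descent iff `u` and followed by a descent iff `v`. If `s`
holds, the weight of a double descent is moved to the corresponding double ascent. -/
noncomputable def turnWeight (s u v : Prop) : ℤ[X] :=
  if v then (if s ∧ u then 0 else X) else (if s ∧ ¬ u then 1 + X else 1)

/-- The product of the weights of all letters, the values in `S` having modified weights. -/
noncomputable def wordWeight (S : Finset (Fin d)) (p : (Fin d → Fin d) × (Fin d → Fin r)) : ℤ[X] :=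
  ∏ i, turnWeight (p.1 i ∈ S) (IsDescent (letter p) i) (IsDescent (letter p) (i + 1))

theorem IsHop.wordWeight_add {v : Fin d} {S : Finset (Fin d)} (hv : v ∉ S)
    {p q : (Fin d → Fin d) × (Fin d → Fin r)} (hp : Function.Bijective p.1) (h : IsHop v p q) :
    wordWeight S p + wordWeight S q = wordWeight (insert v S) p + wordWeight (insert v S) q := by
  obtain ⟨π, rfl, hoff, hat⟩ := h.exists_perm hp.1
  obtain ⟨k, hk⟩ := hp.2 v
  set u : Fin d → Prop := fun i => IsDescent (letter p) i
  set w : Fin d → Prop := fun i => IsDescent (letter p) (i + 1)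
  set u' : Fin d → Prop := fun i => IsDescent (letter (reindex p π)) (π.symm i)
  set w' : Fin d → Prop := fun i => IsDescent (letter (reindex p π)) (π.symm i + 1)
  have hq : ∀ T : Finset (Fin d), wordWeight T (reindex p π) =
      ∏ i, turnWeight (p.1 i ∈ T) (u' i) (w' i) := by
    intro T
    refine Fintype.prod_equiv π _ _ fun j => ?_
    simp [u', w', reindex]
  have hoff' : ∀ i, i ≠ k → u' i = u i ∧ w' i = w i := by
    intro i hi
    have := hoff (π.symm i) (by
      rw [Equiv.apply_symm_apply]
      exact fun h => hi (hp.1 (h.trans hk.symm)))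
    rw [Equiv.apply_symm_apply] at this
    exact ⟨propext this.1, propext this.2⟩
  have hat' := hat (π.symm k) (by rw [Equiv.apply_symm_apply, hk])
  rw [Equiv.apply_symm_apply] at hat'
  have hins : ∀ i, i ≠ k → (p.1 i ∈ insert v S) = (p.1 i ∈ S) := by
    intro i hi
    have : p.1 i ≠ v := fun h => hi (hp.1 (h.trans hk.symm))
    simp [this]
  rw [hq, hq]
  unfold wordWeight
  rw [← Finset.mul_prod_erase _ _ (Finset.mem_univ k),
    ← Finset.mul_prod_erase _ _ (Finset.mem_univ k),
    ← Finset.mul_prod_erase _ _ (Finset.mem_univ k),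
    ← Finset.mul_prod_erase _ _ (Finset.mem_univ k)]
  have e₁ : ∏ i ∈ Finset.univ.erase k, turnWeight (p.1 i ∈ S) (u' i) (w' i) =
      ∏ i ∈ Finset.univ.erase k, turnWeight (p.1 i ∈ S) (u i) (w i) :=
    Finset.prod_congr rfl fun i hi => by
      rw [(hoff' i (Finset.ne_of_mem_erase hi)).1, (hoff' i (Finset.ne_of_mem_erase hi)).2]
  have e₂ : ∏ i ∈ Finset.univ.erase k, turnWeight (p.1 i ∈ insert v S) (u' i) (w' i) =
      ∏ i ∈ Finset.univ.erase k, turnWeight (p.1 i ∈ S) (u i) (w i) :=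
    Finset.prod_congr rfl fun i hi => by
      rw [(hoff' i (Finset.ne_of_mem_erase hi)).1, (hoff' i (Finset.ne_of_mem_erase hi)).2,
        hins i (Finset.ne_of_mem_erase hi)]
  have e₃ : ∏ i ∈ Finset.univ.erase k, turnWeight (p.1 i ∈ insert v S) (u i) (w i) =
      ∏ i ∈ Finset.univ.erase k, turnWeight (p.1 i ∈ S) (u i) (w i) :=
    Finset.prod_congr rfl fun i hi => by rw [hins i (Finset.ne_of_mem_erase hi)]
  change turnWeight (p.1 k ∈ S) (u k) (w k) *
      ∏ i ∈ Finset.univ.erase k, turnWeight (p.1 i ∈ S) (u i) (w i) + _ =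
    turnWeight (p.1 k ∈ insert v S) (u k) (w k) *
      ∏ i ∈ Finset.univ.erase k, turnWeight (p.1 i ∈ insert v S) (u i) (w i) + _
  rw [e₁, e₂, e₃, ← add_mul, ← add_mul]
  congr 1
  change ((¬ (u k ↔ w k) ∧ (u' k ↔ u k) ∧ (w' k ↔ w k)) ∨
    ((u k ↔ w k) ∧ (u' k ↔ ¬ u k) ∧ (w' k ↔ ¬ w k))) at hat'
  have hk₁ : p.1 k ∉ S := by rwa [hk]
  have hk₂ : p.1 k ∈ insert v S := by simp [hk]
  rcases hat' with ⟨h₁, h₂, h₃⟩ | ⟨h₁, h₂, h₃⟩ <;>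
    by_cases hu : u k <;> by_cases hw : w k <;>
    simp_all [turnWeight, add_comm]

open Classical in
theorem sum_wordWeight_insert (r : ℕ) {v : Fin d} {S : Finset (Fin d)} (hv : v ∉ S) :
    ∑ p : (Fin d → Fin d) × (Fin d → Fin r) with Admissible p, wordWeight (insert v S) p =
      ∑ p : (Fin d → Fin d) × (Fin d → Fin r) with Admissible p, wordWeight S p := by
  have hmem : ∀ p : (Fin d → Fin d) × (Fin d → Fin r),
      p ∈ Finset.univ.filter Admissible → Admissible p := fun p hp => (Finset.mem_filter.1 hp).2
  have hop : ∀ (p : (Fin d → Fin d) × (Fin d → Fin r)) (hp : p ∈ Finset.univ.filter Admissible),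
      ∃ q, IsHop v p q := fun p hp => exists_isHop v (hmem p hp).1
  rw [← sub_eq_zero, ← Finset.sum_sub_distrib]
  have hsum : ∀ p (hp : p ∈ Finset.univ.filter Admissible),
      wordWeight (insert v S) p - wordWeight S p +
        (wordWeight (insert v S) (hop p hp).choose - wordWeight S (hop p hp).choose) = 0 := by
    intro p hp
    have := (hop p hp).choose_spec.wordWeight_add hv (hmem p hp).1
    linear_combination -this
  have hadm : ∀ p (hp : p ∈ Finset.univ.filter Admissible),
      (hop p hp).choose ∈ Finset.univ.filter Admissible := fun p hp =>
    Finset.mem_filter.2 ⟨Finset.mem_univ _, (hop p hp).choose_spec.admissible (hmem p hp)⟩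
  refine Finset.sum_involution (fun p hp => (hop p hp).choose) hsum ?_ hadm ?_
  · intro p hp hne heq
    have := hsum p hp
    rw [heq] at this
    exact hne (add_self_eq_zero.1 this)
  · intro p hp
    exact (hop _ (hadm p hp)).choose_spec.unique (hmem _ (hadm p hp)).1.1
      (hop p hp).choose_spec.symm

open Classical in
theorem sum_wordWeight (d r : ℕ) (S : Finset (Fin d)) :
    ∑ p : (Fin d → Fin d) × (Fin d → Fin r) with Admissible p, wordWeight S p =
      ∑ p : (Fin d → Fin d) × (Fin d → Fin r) with Admissible p, wordWeight ∅ p := by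
  induction S using Finset.induction_on with
  | empty => rfl
  | insert v S hv ih => rw [sum_wordWeight_insert r hv, ih]

end Weight

section Statistics

variable {d r : ℕ}

theorem isDescent_letter_succ (p : (Fin d → Fin d) × (Fin d → Fin r)) {j : ℕ} (h : j + 1 < d) :
    IsDescent (letter p) (j + 1) ↔ p.2 ⟨j + 1, h⟩ < p.2 ⟨j, by omega⟩ ∨
      (p.2 ⟨j, by omega⟩ = p.2 ⟨j + 1, h⟩ ∧ p.1 ⟨j + 1, h⟩ < p.1 ⟨j, by omega⟩) := by
  have h₁ := (p.1 ⟨j, by omega⟩).2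
  have h₂ := (p.1 ⟨j + 1, h⟩).2
  unfold IsDescent
  simp only [letter, h, show j < d by omega, dif_pos]
  rw [Fin.lt_def, Fin.ext_iff, Fin.lt_def]
  rcases lt_trichotomy (p.2 ⟨j + 1, h⟩ : ℕ) (p.2 ⟨j, by omega⟩ : ℕ) with h | h | h
  · simp only [h, true_or, iff_true]
    nlinarith
  · simp [h]
  · simp only [h.not_gt, h.ne, false_or, false_and, iff_false, not_lt]
    nlinarith

theorem isDescent_letter_zero (p : (Fin d → Fin d) × (Fin d → Fin r)) (h : 0 < d) :
    IsDescent (letter p) 0 ↔ (p.2 ⟨0, h⟩ : ℕ) = 0 := by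
  have h₁ := (p.1 ⟨0, h⟩).2
  unfold IsDescent
  simp only [letter, h, dif_pos]
  rcases Nat.eq_zero_or_pos (p.2 ⟨0, h⟩ : ℕ) with h₂ | h₂
  · simp [h₂]
  · simp only [h₂.ne', iff_false, not_lt]
    nlinarith

theorem isDescent_letter_last (p : (Fin d → Fin d) × (Fin d → Fin r)) {j : ℕ} (h : j + 1 = d) :
    IsDescent (letter p) (j + 1) ↔ 0 < (p.2 ⟨j, by omega⟩ : ℕ) := by
  have h₁ := (p.1 ⟨j, by omega⟩).2
  unfold IsDescent
  simp only [letter, h, show j < d by omega, dif_pos, lt_irrefl, dif_neg, not_false_eq_true]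
  rcases Nat.eq_zero_or_pos (p.2 ⟨j, by omega⟩ : ℕ) with h₂ | h₂
  · simp [h₂]
  · simp only [h₂, iff_true]
    nlinarith

theorem admissible_iff (hd : 1 ≤ d) (p : (Fin d → Fin d) × (Fin d → Fin r)) :
    Admissible p ↔ Function.Bijective p.1 ∧ (∀ i : Fin d, i.1 = 0 → (p.2 i : ℕ) = 0) ∧
      (∀ i : Fin d, i.1 = d - 1 → (p.2 i : ℕ) = 0) := by
  obtain ⟨e, rfl⟩ : ∃ e, d = e + 1 := ⟨d - 1, by omega⟩
  unfold Admissible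
  rw [isDescent_letter_zero p (by omega), isDescent_letter_last p rfl, @not_lt ℕ _ 0 (p.2 _),
    Nat.le_zero]
  refine and_congr_right fun _ => and_congr ?_ ?_
  · exact ⟨fun h i hi => by rwa [show i = ⟨0, by omega⟩ from Fin.ext hi], fun h => h _ rfl⟩
  · exact ⟨fun h i hi => by rwa [show i = ⟨e, by omega⟩ from Fin.ext hi], fun h => h _ rfl⟩

open Classical in
theorem colDes_eq (p : (Fin d → Fin d) × (Fin d → Fin r)) :
    colDes d r p.1 p.2 = ((Finset.range d).filter fun j => IsDescent (letter p) (j + 1)).card := by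
  have : ∀ i : Fin d, (if h : i.1 + 1 < d then
      p.2 ⟨i.1 + 1, h⟩ < p.2 i ∨ (p.2 i = p.2 ⟨i.1 + 1, h⟩ ∧ p.1 ⟨i.1 + 1, h⟩ < p.1 i)
      else 0 < (p.2 i : ℕ)) ↔ IsDescent (letter p) (i + 1) := by
    intro i
    split_ifs with h
    · exact (isDescent_letter_succ p h).symm
    · exact (isDescent_letter_last p (by omega)).symm
  unfold colDes
  rw [Nat.card_congr (Equiv.subtypeEquivRight this), Nat.card_eq_fintype_card, Fintype.card_subtype,
    Finset.card_filter, Finset.card_filter,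
    Fin.sum_univ_eq_sum_range (fun j => if IsDescent (letter p) (j + 1) then 1 else 0)]

theorem extDes_iff (hd : 1 ≤ d) (p : (Fin d → Fin d) × (Fin d → Fin r)) {i : ℕ} (hi : i ≤ d) :
    extDes d r p.1 p.2 i ↔ IsDescent (letter p) i := by
  unfold extDes
  rcases i with _ | i
  · rw [if_pos rfl, isDescent_letter_zero p hd]
    exact ⟨fun h => h _ rfl, fun h t ht => by rwa [show t = ⟨0, hd⟩ from Fin.ext ht]⟩
  · rw [if_neg (by omega)]
    split_ifs with h₁ h₂
    · exact (isDescent_letter_succ p h₁).symm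
    · rw [isDescent_letter_last p h₂]
      exact ⟨fun h => h ⟨i, by omega⟩ (by simp [← h₂]), fun h t ht => by
        rwa [show t = ⟨i, by omega⟩ from Fin.ext (by simp only; omega)]⟩
    · omega

open Classical in
theorem slideCount_eq (hd : 1 ≤ d) {p : (Fin d → Fin d) × (Fin d → Fin r)} (hp : Admissible p) :
    slideCount d r p.1 p.2 = ((Finset.range d).filter fun j =>
      ¬ IsDescent (letter p) j ∧ IsDescent (letter p) (j + 1)).card + 1 := by
  have : ∀ i, (i ≤ d ∧ extDes d r p.1 p.2 i ∧ (i = 0 ∨ ¬ extDes d r p.1 p.2 (i - 1))) ↔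
      i ∈ (Finset.range (d + 1)).filter fun i =>
        IsDescent (letter p) i ∧ (i = 0 ∨ ¬ IsDescent (letter p) (i - 1)) := by
    intro i
    rw [Finset.mem_filter, Finset.mem_range, Nat.lt_succ_iff]
    refine and_congr_right fun hi => ?_
    rw [extDes_iff hd p hi, extDes_iff hd p (by omega)]
  unfold slideCount
  rw [Nat.card_congr (Equiv.subtypeEquivRight this), Nat.card_eq_fintype_card, Fintype.card_coe,
    Finset.card_filter, Finset.sum_range_succ', Finset.card_filter]
  simp [hp.2.1, and_comm]

open Classical in
/-- In a sequence starting with a descent and ending with an ascent, the turns are counted by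
the descents. -/
theorem card_turns {D : ℕ → Prop} (h0 : D 0) (hd : ¬ D d) :
    ((Finset.range d).filter fun j => D (j + 1)).card =
        ((Finset.range d).filter fun j => D j ∧ D (j + 1)).card +
          ((Finset.range d).filter fun j => ¬ D j ∧ D (j + 1)).card ∧
      d = 2 * ((Finset.range d).filter fun j => ¬ D j ∧ D (j + 1)).card + 1 +
        ((Finset.range d).filter fun j => D j ∧ D (j + 1)).card +
          ((Finset.range d).filter fun j => ¬ D j ∧ ¬ D (j + 1)).card := by
  have h₁ : ∑ j ∈ Finset.range d, (if D j then 1 else 0) =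
      ∑ j ∈ Finset.range d, (if D (j + 1) then 1 else 0) + 1 := by
    have := (Finset.sum_range_succ (fun j => if D j then 1 else 0) d).symm.trans
      (Finset.sum_range_succ' (fun j => if D j then 1 else 0) d)
    simpa [h0, hd] using this
  have h₂ : ∑ j ∈ Finset.range d, (if D (j + 1) then 1 else 0) =
      ∑ j ∈ Finset.range d, (if D j ∧ D (j + 1) then 1 else 0) +
        ∑ j ∈ Finset.range d, (if ¬ D j ∧ D (j + 1) then 1 else 0) := by
    rw [← Finset.sum_add_distrib]
    refine Finset.sum_congr rfl fun j _ => ?_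
    by_cases a : D j <;> by_cases b : D (j + 1) <;> simp [a, b]
  have h₃ : ∑ j ∈ Finset.range d, 1 = ∑ j ∈ Finset.range d, (if D j then 1 else 0) +
      ∑ j ∈ Finset.range d, (if ¬ D j ∧ D (j + 1) then 1 else 0) +
        ∑ j ∈ Finset.range d, (if ¬ D j ∧ ¬ D (j + 1) then 1 else 0) := by
    rw [← Finset.sum_add_distrib, ← Finset.sum_add_distrib]
    refine Finset.sum_congr rfl fun j _ => ?_
    by_cases a : D j <;> by_cases b : D (j + 1) <;> simp [a, b]
  rw [Finset.sum_const, Finset.card_range, smul_eq_mul, mul_one] at h₃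
  simp only [Finset.card_filter]
  omega

theorem wordWeight_empty (p : (Fin d → Fin d) × (Fin d → Fin r)) :
    wordWeight ∅ p = X ^ colDes d r p.1 p.2 := by
  classical
  simp only [wordWeight, turnWeight, Finset.notMem_empty, false_and, if_false]
  rw [Fin.prod_univ_eq_prod_range (fun j => if IsDescent (letter p) (j + 1) then (X : ℤ[X]) else 1),
    colDes_eq, Finset.prod_ite]
  simp

theorem wordWeight_univ (hd : 1 ≤ d) {p : (Fin d → Fin d) × (Fin d → Fin r)} (hp : Admissible p) :
    wordWeight Finset.univ p = if slideCount d r p.1 p.2 = colDes d r p.1 p.2 + 1 then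
      X ^ colDes d r p.1 p.2 * (1 + X) ^ (d - 1 - 2 * colDes d r p.1 p.2) else 0 := by
  classical
  obtain ⟨h₁, h₂⟩ := card_turns hp.2.1 hp.2.2
  rw [slideCount_eq hd hp, colDes_eq, h₁]
  simp only [wordWeight, turnWeight, Finset.mem_univ, true_and]
  rw [Fin.prod_univ_eq_prod_range (fun j => if IsDescent (letter p) (j + 1) then
    (if IsDescent (letter p) j then (0 : ℤ[X]) else X)
    else (if ¬ IsDescent (letter p) j then 1 + X else 1))]
  split_ifs with h
  · have h₃ : ((Finset.range d).filter fun j =>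
        IsDescent (letter p) j ∧ IsDescent (letter p) (j + 1)).card = 0 := by omega
    rw [h₃, zero_add, show d - 1 - 2 * ((Finset.range d).filter fun j =>
        ¬ IsDescent (letter p) j ∧ IsDescent (letter p) (j + 1)).card =
      ((Finset.range d).filter fun j =>
        ¬ IsDescent (letter p) j ∧ ¬ IsDescent (letter p) (j + 1)).card by omega]
    rw [← Finset.prod_const, ← Finset.prod_const, Finset.prod_filter, Finset.prod_filter,
      ← Finset.prod_mul_distrib]
    refine Finset.prod_congr rfl fun j hj => ?_
    have := Finset.filter_eq_empty_iff.1 (Finset.card_eq_zero.1 h₃) hj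
    by_cases a : IsDescent (letter p) j <;> by_cases b : IsDescent (letter p) (j + 1) <;>
      simp [a, b] at this ⊢
  · obtain ⟨j, hj⟩ : ((Finset.range d).filter fun j =>
        IsDescent (letter p) j ∧ IsDescent (letter p) (j + 1)).Nonempty := by
      rw [← Finset.card_pos]
      omega
    rw [Finset.mem_filter] at hj
    exact Finset.prod_eq_zero hj.1 (by simp [hj.2])

theorem two_mul_colDes_lt (hd : 1 ≤ d) {p : (Fin d → Fin d) × (Fin d → Fin r)} (hp : Admissible p)
    (h : slideCount d r p.1 p.2 = colDes d r p.1 p.2 + 1) : 2 * colDes d r p.1 p.2 < d := by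
  classical
  obtain ⟨h₁, h₂⟩ := card_turns hp.2.1 hp.2.2
  rw [slideCount_eq hd hp, colDes_eq] at h
  rw [colDes_eq]
  omega

theorem colDes_le (p : (Fin d → Fin d) × (Fin d → Fin r)) : colDes d r p.1 p.2 ≤ d := by
  classical
  rw [colDes_eq]
  exact (Finset.card_filter_le _ _).trans (Finset.card_range d).le

open Classical in
theorem countDes0_eq (hd : 1 ≤ d) (r m : ℕ) :
    countDes0 r d m = (Finset.univ.filter fun p : (Fin d → Fin d) × (Fin d → Fin r) =>
      Admissible p ∧ colDes d r p.1 p.2 = m).card := by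
  unfold countDes0
  rw [Nat.card_eq_fintype_card, Fintype.card_subtype]
  simp only [admissible_iff hd, and_assoc]

open Classical in
theorem aColored0_eq (hd : 1 ≤ d) (r k s : ℕ) :
    aColored0 r d k s = (Finset.univ.filter fun p : (Fin d → Fin d) × (Fin d → Fin r) =>
      Admissible p ∧ colDes d r p.1 p.2 = k ∧ slideCount d r p.1 p.2 = s + 1).card := by
  unfold aColored0
  rw [Nat.card_eq_fintype_card, Fintype.card_subtype]
  simp only [admissible_iff hd, and_assoc]

open Classical in
theorem sum_countDes0 (hd : 1 ≤ d) (r : ℕ) :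
    ∑ m ∈ Finset.range (d + 1), C (countDes0 r d m : ℤ) * X ^ m =
      ∑ p : (Fin d → Fin d) × (Fin d → Fin r) with Admissible p, wordWeight ∅ p := by
  rw [← Finset.sum_fiberwise_of_maps_to (t := Finset.range (d + 1))
    (g := fun p : (Fin d → Fin d) × (Fin d → Fin r) => colDes d r p.1 p.2)
    fun p _ => Finset.mem_range.2 (Nat.lt_succ_of_le (colDes_le p))]
  refine Finset.sum_congr rfl fun m _ => ?_
  rw [countDes0_eq hd, Finset.filter_filter, Finset.sum_congr rfl
    (g := fun _ => (X : ℤ[X]) ^ m) fun (p : (Fin d → Fin d) × (Fin d → Fin r)) hp => by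
      rw [wordWeight_empty, (Finset.mem_filter.1 hp).2.2]]
  simp

open Classical in
theorem sum_aColored0 (hd : 1 ≤ d) (r : ℕ) :
    ∑ i ∈ Finset.range ((d - 1) / 2 + 1), C (aColored0 r d i i : ℤ) * X ^ i *
        (1 + X) ^ (d - 1 - 2 * i) =
      ∑ p : (Fin d → Fin d) × (Fin d → Fin r) with Admissible p, wordWeight Finset.univ p := by
  rw [Finset.sum_congr rfl fun (p : (Fin d → Fin d) × (Fin d → Fin r)) hp =>
      wordWeight_univ hd (Finset.mem_filter.1 hp).2,
    ← Finset.sum_filter, Finset.filter_filter,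
    ← Finset.sum_fiberwise_of_maps_to (t := Finset.range ((d - 1) / 2 + 1))
      (g := fun p : (Fin d → Fin d) × (Fin d → Fin r) => colDes d r p.1 p.2) fun p hp => by
        obtain ⟨-, h₁, h₂⟩ := Finset.mem_filter.1 hp
        have := two_mul_colDes_lt hd h₁ h₂
        rw [Finset.mem_range]
        omega]
  refine Finset.sum_congr rfl fun i _ => ?_
  rw [Finset.filter_filter, Finset.sum_congr rfl
    (g := fun _ => (X : ℤ[X]) ^ i * (1 + X) ^ (d - 1 - 2 * i))
    fun (p : (Fin d → Fin d) × (Fin d → Fin r)) hp => by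
      rw [(Finset.mem_filter.1 hp).2.2], aColored0_eq hd, Finset.sum_const, nsmul_eq_mul, mul_assoc]
  congr 1
  rw [map_natCast]
  congr 2
  ext p
  simp only [Finset.mem_filter, Finset.mem_univ, true_and]
  constructor
  · rintro ⟨h₁, rfl, h₂⟩
    exact ⟨⟨h₁, h₂⟩, rfl⟩
  · rintro ⟨⟨h₁, h₂⟩, rfl⟩
    exact ⟨h₁, rfl, h₂⟩

end Statistics

end ColoredWord

theorem A0_gamma_positive (d r : ℕ) (hd : 1 ≤ d) (hr : 1 ≤ r) :
    ∑ m ∈ Finset.range (d + 1), Polynomial.C (countDes0 r d m : ℤ) * Polynomial.X ^ m =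
      ∑ i ∈ Finset.range ((d - 1) / 2 + 1), Polynomial.C (aColored0 r d i i : ℤ) *
        Polynomial.X ^ i * (1 + Polynomial.X) ^ (d - 1 - 2 * i) := by
  rw [ColoredWord.sum_countDes0 hd, ColoredWord.sum_aColored0 hd,
    ColoredWord.sum_wordWeight d r Finset.univ]
end
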